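/- Fix z ∈ V. As |s_0| → −∞, for all i', i ∈ V, all ρ', ρ ∈ Rec(z) and all m ∈ ℕ: P_{s_0}{ (i_{τ−1}, ρ_{τ−1}, i_τ, ρ_τ, m_τ) = (i', ρ', i, ρ, m) } → (α_{i'}/κ)·α_i·1{ρ = â_i ρ'}·1{0 ≤ m ≤ |ρ'| − |ρ|}. In particular, in the |s_0| → −∞ limit the vertex i_{τ−1} is independent of the triple (i_τ, ρ_τ, m_τ). -/

import Mathlib

open scoped BigOperators
open Classical Filter

noncomputable section

namespace ThresholdState

variable {V : Type*} [Fintype V] [DecidableEq V]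

/-- `A i j` is the number of directed edges from `i` to `j`. -/
def outdeg (A : V → V → ℕ) (i : V) : ℕ := ∑ j, A i j

def indeg (A : V → V → ℕ) (i : V) : ℕ := ∑ j, A j i

/-- Eulerian: out-degree equals in-degree at every vertex. -/
def Eulerian (A : V → V → ℕ) : Prop := ∀ i, outdeg A i = indeg A i

/-- (Strongly) connected multigraph. -/
def Connected (A : V → V → ℕ) : Prop :=
  ∀ i j : V, Relation.ReflTransGen (fun a b => 0 < A a b) i j

def deg (A : V → V → ℕ) (i : V) : ℕ := outdeg A i

/-- Graph Laplacian: `Δu(i) = -deg(i)·u(i) + Σ_{e incoming to i} u(e⁻)`. -/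
def lap (A : V → V → ℕ) (u : V → ℤ) (i : V) : ℤ :=
  -(deg A i : ℤ) * u i + ∑ j, (A j i : ℤ) * u j

def delta (z : V) : V → ℤ := fun j => if j = z then 1 else 0

/-- Toppling vertex `i`: replace `s` by `s + Δδ_i`. -/
def toppleAt (A : V → V → ℕ) (s : V → ℤ) (i : V) : V → ℤ :=
  fun j => s j + lap A (delta i) j

def applySeq (A : V → V → ℕ) (s : V → ℤ) (l : List V) : V → ℤ :=
  l.foldl (toppleAt A) s

/-- A legal toppling sequence (avoiding the forbidden set `F`): each toppled
vertex is unstable when toppled and does not lie in `F`. -/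
def ValidSeq (A : V → V → ℕ) (F : V → Prop) : (V → ℤ) → List V → Prop
  | _, [] => True
  | s, i :: l => ¬ F i ∧ (deg A i : ℤ) ≤ s i ∧ ValidSeq A F (toppleAt A s i) l

/-- Stable at every non-forbidden vertex. -/
def StableOff (A : V → V → ℕ) (F : V → Prop) (s : V → ℤ) : Prop :=
  ∀ i, ¬ F i → s i ≤ (deg A i : ℤ) - 1

def StabilizesTo (A : V → V → ℕ) (F : V → Prop) (s : V → ℤ) (l : List V) : Prop :=
  ValidSeq A F s l ∧ StableOff A F (applySeq A s l)

def StabilizableVia (A : V → V → ℕ) (F : V → Prop) (s : V → ℤ) : Prop :=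
  ∃ l, StabilizesTo A F s l

/-- Stabilizable with no forbidden vertices. -/
def Stabilizable (A : V → V → ℕ) (s : V → ℤ) : Prop :=
  StabilizableVia A (fun _ => False) s

def stabSeq (A : V → V → ℕ) (F : V → Prop) (s : V → ℤ) : List V :=
  if h : StabilizableVia A F s then h.choose else []

def stabilizeVia (A : V → V → ℕ) (F : V → Prop) (s : V → ℤ) : V → ℤ :=
  applySeq A s (stabSeq A F s)

/-- Odometer: number of topplings at each vertex (`0` everywhere if not stabilizable). -/
def odometerVia (A : V → V → ℕ) (F : V → Prop) (s : V → ℤ) : V → ℕ :=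
  fun i => (stabSeq A F s).count i

def sinkStabilize (A : V → V → ℕ) (z : V) (s : V → ℤ) : V → ℤ :=
  stabilizeVia A (fun i => i = z) s

def sinkOdometer (A : V → V → ℕ) (z : V) (s : V → ℤ) : V → ℕ :=
  odometerVia A (fun i => i = z) s

/-- `ρ` is `z`-recurrent (Dhar's burning test): `ρ(z) = deg z`, `ρ(i) ≤ deg i - 1`
off the sink, and every site other than `z` topples exactly once in the
stabilization of `ρ + Δδ_z` with sink `z`. -/
def ZRec (A : V → V → ℕ) (z : V) (ρ : V → ℤ) : Prop :=
  ρ z = (deg A z : ℤ) ∧ (∀ i, i ≠ z → ρ i ≤ (deg A i : ℤ) - 1) ∧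
  ∃ l : List V, StabilizesTo A (fun i => i = z) (fun j => ρ j + lap A (delta z) j) l ∧
    ∀ i, i ≠ z → l.count i = 1

/-- `κ` = number of `z`-recurrent sandpiles. -/
def kappa (A : V → V → ℕ) (z : V) : ℕ := Nat.card {ρ : V → ℤ // ZRec A z ρ}

def totalMass (s : V → ℤ) : ℤ := ∑ i, s i

/-- Open addition operator `â_i` (with sink `z`). -/
def openAdd (A : V → V → ℕ) (z i : V) (ρ : V → ℤ) : V → ℤ :=
  fun j => if j = z then (deg A z : ℤ) else sinkStabilize A z (fun k => ρ k + delta i k) j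

/-- `â_i⁻¹` on `Rec(z)`. -/
def openAddInv (A : V → V → ℕ) (z i : V) (ρ : V → ℤ) : V → ℤ :=
  if h : ∃ ρ', ZRec A z ρ' ∧ openAdd A z i ρ' = ρ then h.choose else ρ

/-- Burst size `av_{i→z}(ρ) = |â_i⁻¹ρ| - |ρ| + 1`. -/
def burst (A : V → V → ℕ) (z i : V) (ρ : V → ℤ) : ℤ :=
  totalMass (openAddInv A z i ρ) - totalMass ρ + 1

/-- The `z`-recurrent decomposition `s = ρ + m·δ_z + Δv` with `ρ ∈ Rec(z)`, `v(z)=0`. -/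
def ZDecomp (A : V → V → ℕ) (z : V) (s ρ : V → ℤ) (m : ℤ) (v : V → ℤ) : Prop :=
  ZRec A z ρ ∧ v z = 0 ∧ ∀ j, s j = ρ j + m * delta z j + lap A v j

/-- `R_z(s)`: the `z`-recurrent representative of `s`. -/
def Rz (A : V → V → ℕ) (z : V) (s : V → ℤ) : V → ℤ :=
  if h : ∃ ρ, ∃ m, ∃ v, ZDecomp A z s ρ m v then h.choose else s

/-- `m_z(s)`: the integer in the `z`-recurrent decomposition of `s`. -/
def mz (A : V → V → ℕ) (z : V) (s : V → ℤ) : ℤ :=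
  if h : ∃ m, ∃ ρ, ∃ v, ZDecomp A z s ρ m v then h.choose else 0

/-- Closed addition operator `a_i`. -/
def closedAdd (A : V → V → ℕ) (i : V) (s : V → ℤ) : V → ℤ :=
  if Stabilizable A (fun j => s j + delta i j) then
    stabilizeVia A (fun _ => False) (fun j => s j + delta i j)
  else fun j => s j + delta i j

/-- The closed chain after making the additions listed in `w` (in order). -/
def chain (A : V → V → ℕ) (s0 : V → ℤ) (w : List V) : V → ℤ :=
  w.foldl (fun s i => closedAdd A i s) s0

/-- `w` is a threshold word for `s0`: the chain first becomes non-stabilizable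
exactly after the additions in `w`, i.e. `τ = |w|` on the cylinder of `w`. -/
def IsThresholdWord (A : V → V → ℕ) (s0 : V → ℤ) (w : List V) : Prop :=
  ¬ Stabilizable A (chain A s0 w) ∧
  ∀ w' : List V, w' <+: w → w' ≠ w → Stabilizable A (chain A s0 w')

def wordProb (α : V → ℝ) (w : List V) : ℝ := (w.map α).prod

/-- `P_{s0}(E at the threshold time)`: total probability of the (disjoint)
cylinders of threshold words satisfying `E`. -/
def thresholdProb (A : V → V → ℕ) (α : V → ℝ) (s0 : V → ℤ) (E : List V → Prop) : ℝ :=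
  ∑' w : List V, if IsThresholdWord A s0 w ∧ E w then wordProb α w else 0

/-- `E_{s0}[f at the threshold time]`. -/
def thresholdExp (A : V → V → ℕ) (α : V → ℝ) (s0 : V → ℤ) (f : List V → ℝ) : ℝ :=
  ∑' w : List V, if IsThresholdWord A s0 w then wordProb α w * f w else 0

end ThresholdState

set_option linter.unusedSectionVars false

namespace ThresholdState

variable {V : Type*} [Fintype V] [DecidableEq V] {A : V → V → ℕ} {z : V}

lemma lap_add (u v : V → ℤ) (i : V) :
    lap A (fun j => u j + v j) i = lap A u i + lap A v i := by
  simp only [lap, mul_add, Finset.sum_add_distrib]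
  ring

lemma lap_mul (c : ℤ) (u : V → ℤ) (i : V) :
    lap A (fun j => c * u j) i = c * lap A u i := by
  simp only [lap, mul_add, Finset.mul_sum]
  congr 1
  · ring
  · exact Finset.sum_congr rfl fun j _ => by ring

lemma lap_neg (u : V → ℤ) (i : V) : lap A (fun j => -u j) i = -lap A u i := by
  simpa using lap_mul (A := A) (-1) u i

lemma lap_sub (u v : V → ℤ) (i : V) :
    lap A (fun j => u j - v j) i = lap A u i - lap A v i := by
  simpa [sub_eq_add_neg, lap_neg] using lap_add (A := A) u (fun j => -v j) i

lemma Eulerian.deg_eq (hE : Eulerian A) (i : V) : (deg A i : ℤ) = ∑ j, (A j i : ℤ) := by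
  have := hE i
  rw [deg, this, indeg]
  push_cast
  rfl

lemma Eulerian.lap_eq (hE : Eulerian A) (u : V → ℤ) (i : V) :
    lap A u i = ∑ j, (A j i : ℤ) * (u j - u i) := by
  rw [lap, hE.deg_eq]
  simp only [mul_sub, Finset.sum_sub_distrib, ← Finset.sum_mul]
  ring

lemma Eulerian.lap_const (hE : Eulerian A) (c : ℤ) (i : V) : lap A (fun _ => c) i = 0 := by
  simp [hE.lap_eq]

lemma lap_delta (i j : V) :
    lap A (delta i) j = (if j = i then -(deg A j : ℤ) else 0) + A i j := by
  simp [lap, delta]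

lemma totalMass_add (s t : V → ℤ) :
    totalMass (fun j => s j + t j) = totalMass s + totalMass t := by
  simp [totalMass, Finset.sum_add_distrib]

lemma totalMass_lap (u : V → ℤ) : totalMass (lap A u) = 0 := by
  simp only [totalMass, lap, Finset.sum_add_distrib]
  rw [Finset.sum_comm]
  simp [← Finset.sum_mul, deg, outdeg]

lemma totalMass_mul_delta (c : ℤ) : totalMass (fun j => c * delta z j) = c := by
  simp [totalMass, delta]

lemma totalMass_delta (i : V) : totalMass (delta i) = 1 := by
  simp [totalMass, delta]

lemma applySeq_eq (s : V → ℤ) (l : List V) :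
    applySeq A s l = fun j => s j + lap A (fun k => (l.count k : ℤ)) j := by
  induction l generalizing s with
  | nil => simp [applySeq, lap]
  | cons i l ih =>
    have h : applySeq A s (i :: l) = applySeq A (toppleAt A s i) l := rfl
    rw [h, ih]
    funext j
    have h2 : (fun k => (((i :: l).count k : ℕ) : ℤ)) =
        fun k => (delta i k + (l.count k : ℤ)) := by
      funext k
      by_cases hk : k = i
      · subst hk; simp [delta]; ring
      · simp [delta, hk, Ne.symm hk]
    rw [h2, lap_add, toppleAt]
    ring

/-- A least-action principle: a nonnegative function that stabilizes `s` off `F` bounds every legal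
toppling sequence, so `s` is stabilizable. -/
lemma stabilizableVia_of_nonneg (F : V → Prop) (s : V → ℤ) (w : V → ℕ)
    (h : StableOff A F (fun j => s j + lap A (fun k => (w k : ℤ)) j)) :
    StabilizableVia A F s := by
  induction hn : ∑ j, w j generalizing s w with
  | zero =>
    have hw : w = fun _ => 0 := by
      funext j
      exact (Finset.sum_eq_zero_iff.mp hn) j (Finset.mem_univ j)
    subst hw
    refine ⟨[], trivial, ?_⟩
    intro i hi
    have := h i hi
    simpa [lap, applySeq] using this
  | succ n ih =>
    by_cases hs : StableOff A F s
    · exact ⟨[], trivial, hs⟩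
    · simp only [StableOff, not_forall] at hs
      obtain ⟨i, hi, hsi⟩ := hs
      have hw : 0 < w i := by
        by_contra h0
        have h0 : w i = 0 := by omega
        have h1 := h i hi
        have h2 : 0 ≤ lap A (fun k => (w k : ℤ)) i := by
          simp only [lap, h0]
          simp only [Nat.cast_zero, mul_zero, zero_add]
          positivity
        simp only at h1
        omega
      have hw' : (fun k => (w k : ℤ)) =
          fun k => delta i k + ((Function.update w i (w i - 1) k : ℕ) : ℤ) := by
        funext k
        by_cases hk : k = i
        · subst hk; simp [delta]; omega
        · simp [delta, hk]
      obtain ⟨l, hl, hl'⟩ := ih (toppleAt A s i) (Function.update w i (w i - 1)) (by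
        intro j hj
        have h1 := h j hj
        simp only [hw', lap_add] at h1
        simp only [toppleAt]
        linarith) (by
        rw [Finset.sum_update_of_mem (Finset.mem_univ i)]
        rw [← Finset.add_sum_erase _ _ (Finset.mem_univ i)] at hn
        rw [Finset.sdiff_singleton_eq_erase]
        omega)
      exact ⟨i :: l, ⟨hi, by omega, hl⟩, hl'⟩

lemma stabilizableVia_of_lap (hE : Eulerian A) (F : V → Prop) (s w : V → ℤ)
    (h : StableOff A F (fun j => s j + lap A w j)) : StabilizableVia A F s := by
  refine stabilizableVia_of_nonneg F s (fun j => (w j + ∑ k, |w k|).toNat) ?_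
  have hw : (fun k => (((w k + ∑ k, |w k|).toNat : ℕ) : ℤ)) = fun k => w k + ∑ k, |w k| := by
    funext k
    have h1 : |w k| ≤ ∑ k, |w k| :=
      Finset.single_le_sum (f := fun k => |w k|) (fun _ _ => abs_nonneg _) (Finset.mem_univ k)
    have h2 := neg_abs_le (w k)
    rw [Int.toNat_of_nonneg]
    linarith
  intro i hi
  have := h i hi
  simp only [hw]
  rw [lap_add, hE.lap_const]
  linarith

/-- A function that is strictly superharmonic away from the sink. -/
lemma exists_lap_le_neg_one (hE : Eulerian A) (hC : Connected A) (z : V) :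
    ∃ h : V → ℤ, ∀ i, i ≠ z → lap A h i ≤ -1 := by
  let P : Finset V → Prop := fun S => z ∈ S ∧ ∃ h : V → ℤ, ∃ M : ℤ,
    (∀ i, i ∈ S → i ≠ z → lap A h i ≤ -1) ∧ (∀ i, i ∉ S → h i = M) ∧ ∀ i, i ∈ S → h i < M
  have h0 : ∃ S, P S := by
    refine ⟨{z}, by simp, fun j => if j = z then 0 else 1, 1, ?_, ?_, ?_⟩
    · intro i hi hz
      simp_all
    · intro i hi
      simp_all
    · intro i hi
      simp_all
  obtain ⟨S, hS⟩ : ∃ S : Finset V, Maximal P S := by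
    obtain ⟨S, hS⟩ := h0
    obtain ⟨T, -, hT⟩ := (Set.toFinite {S | P S}).exists_le_maximal hS
    exact ⟨T, hT⟩
  obtain ⟨hz, h, M, h1, h2, h3⟩ := hS.prop
  by_cases hU : S = Finset.univ
  · exact ⟨h, fun i hi => h1 i (by simp [hU]) hi⟩
  exfalso
  obtain ⟨x, hx⟩ : ∃ x, x ∉ S := by
    by_contra! hh
    exact hU (Finset.eq_univ_iff_forall.mpr hh)
  obtain ⟨a, ha, i, hi, hai⟩ : ∃ a ∈ S, ∃ i, i ∉ S ∧ 0 < A a i := by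
    by_contra! hh
    have key : ∀ y, Relation.ReflTransGen (fun a b => 0 < A a b) z y → y ∈ S := by
      intro y hy
      induction hy with
      | refl => exact hz
      | tail _ hbc ih =>
        by_contra hc
        have := hh _ ih _ hc
        omega
    exact hx (key x (hC z x))
  have hiz : i ≠ z := fun e => hi (e ▸ hz)
  have hi1 : lap A h i ≤ -1 := by
    rw [hE.lap_eq, ← Finset.add_sum_erase _ _ (Finset.mem_univ a)]
    have e1 : (A a i : ℤ) * (h a - h i) ≤ -1 := by
      have := h3 a ha
      rw [h2 i hi]
      have : (1 : ℤ) ≤ A a i := by exact_mod_cast hai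
      nlinarith
    have e2 : ∑ j ∈ Finset.univ.erase a, (A j i : ℤ) * (h j - h i) ≤ 0 := by
      refine Finset.sum_nonpos fun j _ => ?_
      have : h j ≤ h i := by
        rw [h2 i hi]
        by_cases hj : j ∈ S
        · exact (h3 j hj).le
        · exact (h2 j hj).le
      exact mul_nonpos_of_nonneg_of_nonpos (by positivity) (by linarith)
    linarith
  let B : ℤ := 1 + ∑ j, (deg A j : ℤ)
  have hB : ∀ j, (deg A j : ℤ) + 1 ≤ B := fun j => by
    have : (deg A j : ℤ) ≤ ∑ j, (deg A j : ℤ) :=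
      Finset.single_le_sum (f := fun j => (deg A j : ℤ)) (fun _ _ => by positivity)
        (Finset.mem_univ j)
    simp only [B]
    linarith
  let g : V → ℤ := fun j => if j ∈ insert i S then 0 else 1
  have hg : ∀ j, j ∈ insert i S → lap A g j ≤ deg A j := fun j hj => by
    rw [hE.lap_eq, hE.deg_eq]
    refine Finset.sum_le_sum fun k _ => ?_
    have : g k - g j ≤ 1 := by
      simp only [g, if_pos hj]
      split_ifs <;> norm_num
    nlinarith [Int.natCast_nonneg (A k j)]
  have hP : P (insert i S) := by
    refine ⟨by simp [hz], fun j => B * h j + g j, B * M + 1, ?_, ?_, ?_⟩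
    · intro j hj hjz
      rw [lap_add, lap_mul]
      have e1 : lap A h j ≤ -1 := by
        rcases Finset.mem_insert.mp hj with e | e
        · exact e ▸ hi1
        · exact h1 j e hjz
      have e2 := hg j hj
      have e3 := hB j
      have : (0 : ℤ) ≤ deg A j := by positivity
      nlinarith
    · intro j hj
      have : g j = 1 := if_neg hj
      rw [Finset.mem_insert, not_or] at hj
      simp only [this, h2 j hj.2]
    · intro j hj
      have e : g j = 0 := if_pos hj
      have e3 := hB j
      have : h j ≤ M := by
        by_cases hj : j ∈ S
        · exact (h3 j hj).le
        · exact (h2 j hj).le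
      simp only [e]
      have : (0 : ℤ) ≤ deg A j := by positivity
      nlinarith
  exact hi (hS.le_of_ge hP (Finset.subset_insert i S) (Finset.mem_insert_self i S))

/-- Some multiple of a strictly superharmonic function pushes any configuration above any other
one away from the sink. -/
lemma exists_lap_ge (hE : Eulerian A) (hC : Connected A) (z : V) (t : V → ℤ) :
    ∃ u : V → ℤ, ∀ i, i ≠ z → t i ≤ lap A u i := by
  obtain ⟨h, hh⟩ := exists_lap_le_neg_one hE hC z
  refine ⟨fun j => (-∑ k, |t k|) * h j, fun i hi => ?_⟩
  rw [lap_mul]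
  have h1 : |t i| ≤ ∑ k, |t k| :=
    Finset.single_le_sum (f := fun k => |t k|) (fun _ _ => abs_nonneg _) (Finset.mem_univ i)
  have h2 := le_abs_self (t i)
  have h3 := abs_nonneg (t i)
  have := hh i hi
  nlinarith

lemma sinkStabilizable (hE : Eulerian A) (hC : Connected A) (z : V) (s : V → ℤ) :
    StabilizableVia A (fun i => i = z) s := by
  obtain ⟨u, hu⟩ := exists_lap_ge hE hC z (fun i => s i - (deg A i - 1))
  refine stabilizableVia_of_lap hE _ s (fun j => -u j) fun i hi => ?_
  have := hu i hi
  simp only [lap_neg]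
  linarith

lemma stabSeq_spec {F : V → Prop} {s : V → ℤ} (h : StabilizableVia A F s) :
    StabilizesTo A F s (stabSeq A F s) := by
  rw [stabSeq, dif_pos h]
  exact h.choose_spec

lemma ValidSeq.not_mem {F : V → Prop} {s : V → ℤ} {l : List V} (h : ValidSeq A F s l) {i : V}
    (hi : F i) : i ∉ l := by
  induction l generalizing s with
  | nil => simp
  | cons j l ih =>
    obtain ⟨h1, -, h3⟩ := h
    simp only [List.mem_cons, not_or]
    exact ⟨fun e => h1 (e ▸ hi), ih h3⟩

/-- No forbidden subconfiguration: in every nonempty set avoiding `z`, some site has at least as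
many particles as edges arriving from the set. -/
def NoForbidden (A : V → V → ℕ) (z : V) (s : V → ℤ) : Prop :=
  ∀ U : Finset V, U.Nonempty → z ∉ U → ∃ i ∈ U, ∑ j ∈ U, (A j i : ℤ) ≤ s i

lemma NoForbidden.mono {s t : V → ℤ} (h : NoForbidden A z s) (hst : ∀ i, i ≠ z → s i ≤ t i) :
    NoForbidden A z t := fun U hU hz => by
  obtain ⟨i, hi, h1⟩ := h U hU hz
  exact ⟨i, hi, h1.trans (hst i fun e => hz (e ▸ hi))⟩

lemma NoForbidden.toppleAt {s : V → ℤ} (h : NoForbidden A z s) {k : V}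
    (hk : (deg A k : ℤ) ≤ s k) : NoForbidden A z (toppleAt A s k) := fun U hU hz => by
  by_cases hkU : k ∈ U
  · by_cases hU' : (U.erase k).Nonempty
    · obtain ⟨i, hi, h1⟩ := h (U.erase k) hU' (fun e => hz (Finset.mem_of_mem_erase e))
      refine ⟨i, Finset.mem_of_mem_erase hi, ?_⟩
      rw [ThresholdState.toppleAt, lap_delta, if_neg (Finset.ne_of_mem_erase hi),
        ← Finset.add_sum_erase _ _ hkU]
      linarith
    · refine ⟨k, hkU, ?_⟩
      rw [← Finset.add_sum_erase _ _ hkU, Finset.not_nonempty_iff_eq_empty.mp hU']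
      rw [ThresholdState.toppleAt, lap_delta, if_pos rfl]
      simp only [Finset.sum_empty]
      linarith
  · obtain ⟨i, hi, h1⟩ := h U hU hz
    refine ⟨i, hi, ?_⟩
    rw [ThresholdState.toppleAt, lap_delta, if_neg (show i ≠ k from fun e => hkU (e ▸ hi))]
    have : (0 : ℤ) ≤ A k i := by positivity
    linarith

lemma NoForbidden.applySeq {F : V → Prop} {s : V → ℤ} (h : NoForbidden A z s) {l : List V}
    (hl : ValidSeq A F s l) : NoForbidden A z (applySeq A s l) := by
  induction l generalizing s with
  | nil => exact h
  | cons i l ih => exact ih (h.toppleAt hl.2.1) hl.2.2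

lemma exists_split_first (l : List V) (U : Finset V) (h : ∃ i ∈ U, i ∈ l) :
    ∃ l₁ i l₂, l = l₁ ++ i :: l₂ ∧ i ∈ U ∧ ∀ j ∈ l₁, j ∉ U := by
  induction l with
  | nil => simp at h
  | cons a l ih =>
    by_cases ha : a ∈ U
    · exact ⟨[], a, l, rfl, ha, by simp⟩
    · obtain ⟨i, hi, hil⟩ := h
      have : i ∈ l := (List.mem_cons.mp hil).resolve_left fun e => ha (e ▸ hi)
      obtain ⟨l₁, j, l₂, e, h1, h2⟩ := ih ⟨i, hi, this⟩
      refine ⟨a :: l₁, j, l₂, by simp [e], h1, ?_⟩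
      intro k hk
      rcases List.mem_cons.mp hk with e | e
      · exact e ▸ ha
      · exact h2 k e

lemma ValidSeq.append {F : V → Prop} {s : V → ℤ} {l₁ l₂ : List V} :
    ValidSeq A F s (l₁ ++ l₂) ↔ ValidSeq A F s l₁ ∧ ValidSeq A F (applySeq A s l₁) l₂ := by
  induction l₁ generalizing s with
  | nil => simp [ValidSeq, ThresholdState.applySeq]
  | cons i l₁ ih =>
    simp only [List.cons_append, ValidSeq, ih, and_assoc]
    rfl

lemma ZRec.noForbidden (hE : Eulerian A) {ρ : V → ℤ} (h : ZRec A z ρ) : NoForbidden A z ρ := by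
  obtain ⟨-, -, l, ⟨hl, -⟩, hcount⟩ := h
  intro U hU hz
  have hzl := hl.not_mem (i := z) rfl
  obtain ⟨x, hx⟩ := hU
  have hxz : x ≠ z := fun e => hz (e ▸ hx)
  obtain ⟨l₁, i, l₂, rfl, hi, h1⟩ := exists_split_first l U
    ⟨x, hx, List.count_pos_iff.mp (by rw [hcount x hxz]; norm_num)⟩
  refine ⟨i, hi, ?_⟩
  have hv := (ValidSeq.append.mp hl).2.2.1
  rw [applySeq_eq] at hv
  simp only at hv
  rw [lap_delta, if_neg (show i ≠ z from fun e => hz (e ▸ hi)), lap,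
    List.count_eq_zero_of_not_mem (fun e => h1 i e hi), hE.deg_eq] at hv
  have h3 : ∀ j, (A j i : ℤ) * (l₁.count j : ℤ) + (if j = z then (A z i : ℤ) else 0) ≤
      if j ∈ U then 0 else (A j i : ℤ) := by
    intro j
    by_cases hjU : j ∈ U
    · have hjz : j ≠ z := fun e => hz (e ▸ hjU)
      simp [hjU, hjz, List.count_eq_zero_of_not_mem (fun e => h1 j e hjU)]
    · by_cases hjz : j = z
      · subst hjz
        have : j ∉ l₁ := fun e => hzl (by simp [e])
        simp [hjU, List.count_eq_zero_of_not_mem this]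
      · have e1 := hcount j hjz
        rw [List.count_append] at e1
        have e2 : ((l₁.count j : ℕ) : ℤ) ≤ 1 := by exact_mod_cast (by omega)
        simp only [hjU, hjz, if_false, add_zero]
        nlinarith [Int.natCast_nonneg (A j i)]
  have h4 := Finset.sum_le_sum fun j (_ : j ∈ Finset.univ) => h3 j
  rw [Finset.sum_add_distrib] at h4
  simp only [Finset.sum_ite_eq', Finset.mem_univ, if_true] at h4
  have h5 : ∑ j, (A j i : ℤ) = ∑ j ∈ U, (A j i : ℤ) + ∑ j, if j ∈ U then 0 else (A j i : ℤ) := by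
    rw [← Finset.sum_filter_add_sum_filter_not Finset.univ (· ∈ U)]
    congr 1
    · simp
    · rw [Finset.sum_filter]
      simp only [ite_not]
  simp only [Nat.cast_zero, mul_zero, zero_add] at hv
  linarith

lemma exists_burning (hE : Eulerian A) {ρ : V → ℤ} (h : NoForbidden A z ρ) (n : ℕ)
    (hn : n + 1 ≤ Fintype.card V) :
    ∃ l : List V, l.Nodup ∧ l.length = n ∧
      ValidSeq A (fun i => i = z) (fun j => ρ j + lap A (delta z) j) l := by
  induction n with
  | zero => exact ⟨[], by simp, rfl, trivial⟩
  | succ n ih =>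
    obtain ⟨l, hl1, hl2, hl3⟩ := ih (by omega)
    have hzl := hl3.not_mem (i := z) rfl
    let T : Finset V := insert z l.toFinset
    have hT : T.card = n + 1 := by
      rw [Finset.card_insert_of_notMem (by simpa using hzl), List.toFinset_card_of_nodup hl1, hl2]
    have hne : (Finset.univ \ T).Nonempty := by
      rw [← Finset.card_pos, Finset.card_sdiff_of_subset (Finset.subset_univ _), hT,
        Finset.card_univ]
      omega
    obtain ⟨i, hi, h1⟩ := h _ hne (by simp [T])
    have hi' : i ≠ z ∧ i ∉ l := by simpa [T] using hi
    refine ⟨l ++ [i], ?_, by simp [hl2], ValidSeq.append.mpr ⟨hl3, hi'.1, ?_, trivial⟩⟩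
    · exact List.Nodup.append hl1 (by simp) (by simpa using hi'.2)
    · rw [applySeq_eq]
      simp only
      rw [lap_delta, if_neg hi'.1, lap, List.count_eq_zero_of_not_mem hi'.2, hE.deg_eq]
      have h3 : ∀ j, (if j ∈ T then (A j i : ℤ) else 0) =
          (A j i : ℤ) * (l.count j : ℤ) + (if j = z then (A z i : ℤ) else 0) := by
        intro j
        by_cases hjz : j = z
        · subst hjz
          simp [T, List.count_eq_zero_of_not_mem hzl]
        · by_cases hjl : j ∈ l
          · simp [T, hjz, hjl, List.count_eq_one_of_mem hl1 hjl]
          · simp [T, hjz, hjl, List.count_eq_zero_of_not_mem hjl]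
      have h4 := Finset.sum_congr (rfl : Finset.univ = Finset.univ) fun j (_ : j ∈ Finset.univ) => h3 j
      rw [Finset.sum_add_distrib] at h4
      simp only [Finset.sum_ite_eq', Finset.mem_univ, if_true, Finset.sum_ite_mem,
        Finset.univ_inter] at h4
      have h5 := Finset.sum_sdiff (f := fun j => (A j i : ℤ)) (Finset.subset_univ T)
      simp only [Nat.cast_zero, mul_zero, zero_add]
      linarith

lemma zrec_iff (hE : Eulerian A) {ρ : V → ℤ} :
    ZRec A z ρ ↔ ρ z = (deg A z : ℤ) ∧ (∀ i, i ≠ z → ρ i ≤ (deg A i : ℤ) - 1) ∧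
      NoForbidden A z ρ := by
  refine ⟨fun h => ⟨h.1, h.2.1, h.noForbidden hE⟩, fun ⟨h1, h2, h3⟩ => ⟨h1, h2, ?_⟩⟩
  have hpos : 0 < Fintype.card V := Fintype.card_pos_iff.mpr ⟨z⟩
  obtain ⟨l, hl1, hl2, hl3⟩ := exists_burning hE h3 (Fintype.card V - 1) (by omega)
  have hzl := hl3.not_mem (i := z) rfl
  have huniv : insert z l.toFinset = Finset.univ := by
    rw [← Finset.card_eq_iff_eq_univ, Finset.card_insert_of_notMem (by simpa using hzl),
      List.toFinset_card_of_nodup hl1, hl2]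
    omega
  have hcount : ∀ i, i ≠ z → l.count i = 1 := fun i hi => by
    have : i ∈ insert z l.toFinset := huniv ▸ Finset.mem_univ i
    exact List.count_eq_one_of_mem hl1 (by simpa [hi] using this)
  refine ⟨l, ⟨hl3, fun i hi => ?_⟩, hcount⟩
  have e : (fun k => delta z k + (l.count k : ℤ)) = fun _ => 1 := by
    funext k
    by_cases hk : k = z
    · subst hk; simp [delta, List.count_eq_zero_of_not_mem hzl]
    · simp [delta, hk, hcount k hk]
  rw [applySeq_eq]
  simp only
  rw [add_assoc, ← lap_add, e, hE.lap_const]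
  simpa using h2 i hi

/-- At a minimum of `v`, the Laplacian gains at least the edges coming from outside the set of
minimizers; hence adding it to a configuration without forbidden subconfigurations makes some
minimizer unstable. -/
lemma exists_unstable_of_min (hE : Eulerian A) {ρ v : V → ℤ} (hρ : NoForbidden A z ρ) {x : V}
    (hx : ∀ j, v x ≤ v j) (hxz : v x < v z) :
    ∃ i, i ≠ z ∧ (deg A i : ℤ) ≤ ρ i + lap A v i := by
  let U : Finset V := Finset.univ.filter fun j => v j = v x
  have hzU : z ∉ U := by
    simp only [U, Finset.mem_filter, not_and]
    intro _ e
    omega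
  obtain ⟨i, hi, h1⟩ := hρ U ⟨x, by simp [U]⟩ hzU
  refine ⟨i, fun e => hzU (e ▸ hi), ?_⟩
  have hix : v i = v x := by simpa [U] using hi
  have h2 : ∑ j, (if j ∈ U then 0 else (A j i : ℤ)) ≤ lap A v i := by
    rw [hE.lap_eq]
    refine Finset.sum_le_sum fun j _ => ?_
    split_ifs with hj
    · have : v j = v x := by simpa [U] using hj
      simp [this, hix]
    · have h3 : v j ≠ v x := by simpa [U] using hj
      have h4 : v i + 1 ≤ v j := by
        have := hx j
        omega
      nlinarith [Int.natCast_nonneg (A j i)]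
  have h5 : ∑ j, (A j i : ℤ) = ∑ j ∈ U, (A j i : ℤ) + ∑ j, if j ∈ U then 0 else (A j i : ℤ) := by
    rw [← Finset.sum_filter_add_sum_filter_not Finset.univ (· ∈ U)]
    congr 1
    · simp
    · rw [Finset.sum_filter]
      simp only [ite_not]
  rw [hE.deg_eq]
  linarith

lemma ZRec.le_of_equiv (hE : Eulerian A) {ρ₁ ρ₂ v : V → ℤ} (h₁ : ZRec A z ρ₁) (h₂ : ZRec A z ρ₂)
    (c : ℤ) (h : ∀ j, ρ₁ j = ρ₂ j + c * delta z j + lap A v j) (j : V) : v z ≤ v j := by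
  obtain ⟨x, -, hx⟩ := Finset.exists_min_image Finset.univ v ⟨z, Finset.mem_univ z⟩
  by_contra hj
  have h3 := hx j (Finset.mem_univ j)
  obtain ⟨i, hi, h4⟩ := exists_unstable_of_min hE (h₂.noForbidden hE) (x := x) (v := v)
    (fun k => hx k (Finset.mem_univ k)) (by omega)
  have h5 := h₁.2.1 i hi
  have h6 := h i
  simp only [delta, hi, if_false, mul_zero, add_zero] at h6
  omega

lemma ZRec.eq_of_equiv (hE : Eulerian A) {ρ₁ ρ₂ v : V → ℤ} (h₁ : ZRec A z ρ₁) (h₂ : ZRec A z ρ₂)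
    (c : ℤ) (h : ∀ j, ρ₁ j = ρ₂ j + c * delta z j + lap A v j) : ρ₁ = ρ₂ := by
  have h3 := h₁.le_of_equiv hE h₂ c h
  have h4 := h₂.le_of_equiv (v := fun j => -v j) hE h₁ (-c) fun j => by
    rw [lap_neg, h j]
    ring
  have h5 : v = fun _ => v z := by
    funext j
    have := h3 j
    have := h4 j
    omega
  funext j
  by_cases hj : j = z
  · subst hj
    rw [h₁.1, h₂.1]
  · rw [h j, h5, hE.lap_const]
    simp [delta, hj]

lemma exists_zdecomp (hE : Eulerian A) (hC : Connected A) (z : V) (s : V → ℤ) :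
    ∃ ρ m v, ZDecomp A z s ρ m v := by
  obtain ⟨u, hu⟩ := exists_lap_ge hE hC z (fun i => deg A i - s i)
  have h1 : NoForbidden A z (fun j => s j + lap A u j) := fun U ⟨i, hi⟩ hz => by
    refine ⟨i, hi, ?_⟩
    have h2 := hu i fun e => hz (e ▸ hi)
    have h3 : ∑ j ∈ U, (A j i : ℤ) ≤ deg A i := by
      rw [hE.deg_eq]
      exact Finset.sum_le_sum_of_subset_of_nonneg (Finset.subset_univ U)
        fun _ _ _ => Int.natCast_nonneg _
    linarith
  obtain ⟨l, hl, hl'⟩ := sinkStabilizable hE hC z (fun j => s j + lap A u j)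
  have h4 := h1.applySeq hl
  rw [applySeq_eq] at h4 hl'
  let w : V → ℤ := fun k => u k + (l.count k : ℤ)
  have hw : ∀ j, s j + lap A u j + lap A (fun k => (l.count k : ℤ)) j = s j + lap A w j :=
    fun j => by
      rw [lap_add]
      ring
  simp only [hw] at h4 hl'
  let ρ : V → ℤ := fun j => if j = z then deg A z else s j + lap A w j
  refine ⟨ρ, s z + lap A w z - deg A z, fun j => -w j + w z, (zrec_iff hE).mpr ⟨?_, ?_, ?_⟩, ?_, ?_⟩
  · simp [ρ]
  · intro i hi
    simpa [ρ, hi] using hl' i hi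
  · refine h4.mono fun i hi => ?_
    simp [ρ, hi]
  · simp
  · intro j
    have e : lap A (fun j => -w j + w z) j = -lap A w j := by
      rw [lap_add (fun j => -w j) (fun _ => w z), hE.lap_const, lap_neg, add_zero]
    rw [e]
    by_cases hj : j = z
    · subst hj
      simp [ρ, delta]
    · simp [ρ, delta, hj]

lemma ZDecomp.mass {s ρ v : V → ℤ} {m : ℤ} (h : ZDecomp A z s ρ m v) :
    m = totalMass s - totalMass ρ := by
  have e : s = fun j => (ρ j + m * delta z j) + lap A v j := funext h.2.2
  rw [e, totalMass_add, totalMass_add, totalMass_lap, totalMass_mul_delta]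
  ring

lemma Rz_spec (hE : Eulerian A) (hC : Connected A) (z : V) (s : V → ℤ) :
    ∃ m v, ZDecomp A z s (Rz A z s) m v := by
  have h : ∃ ρ, ∃ m, ∃ v, ZDecomp A z s ρ m v := exists_zdecomp hE hC z s
  rw [Rz, dif_pos h]
  exact h.choose_spec

lemma zrec_Rz (hE : Eulerian A) (hC : Connected A) (z : V) (s : V → ℤ) :
    ZRec A z (Rz A z s) := by
  obtain ⟨m, v, h⟩ := Rz_spec hE hC z s
  exact h.1

lemma Rz_eq_of_equiv (hE : Eulerian A) (hC : Connected A) {s ρ v : V → ℤ} (hρ : ZRec A z ρ)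
    (c : ℤ) (h : ∀ j, s j = ρ j + c * delta z j + lap A v j) : Rz A z s = ρ := by
  obtain ⟨m, v', h'⟩ := Rz_spec hE hC z s
  refine h'.1.eq_of_equiv (v := fun j => v j - v' j) hE hρ (c - m) fun j => ?_
  have h1 := h j
  have h2 := h'.2.2 j
  rw [lap_sub]
  linarith

lemma mz_eq (hE : Eulerian A) (hC : Connected A) (z : V) (s : V → ℤ) :
    mz A z s = totalMass s - totalMass (Rz A z s) := by
  have h : ∃ m, ∃ ρ, ∃ v, ZDecomp A z s ρ m v := by
    obtain ⟨ρ, m, v, h⟩ := exists_zdecomp hE hC z s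
    exact ⟨m, ρ, v, h⟩
  rw [mz, dif_pos h]
  obtain ⟨ρ, v, h'⟩ := h.choose_spec
  rw [Rz_eq_of_equiv hE hC h'.1 _ h'.2.2]
  exact h'.mass

lemma Rz_spec_mz (hE : Eulerian A) (hC : Connected A) (z : V) (s : V → ℤ) :
    ∃ v, ZDecomp A z s (Rz A z s) (mz A z s) v := by
  obtain ⟨m, v, h⟩ := Rz_spec hE hC z s
  refine ⟨v, ?_⟩
  rw [mz_eq hE hC, ← h.mass]
  exact h

lemma Rz_congr (hE : Eulerian A) (hC : Connected A) {s t v : V → ℤ} (c : ℤ)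
    (h : ∀ j, s j = t j + c * delta z j + lap A v j) : Rz A z s = Rz A z t := by
  obtain ⟨m, v', h'⟩ := Rz_spec hE hC z t
  refine Rz_eq_of_equiv (v := fun j => v j + v' j) hE hC h'.1 (c + m) fun j => ?_
  rw [lap_add, h j, h'.2.2 j]
  ring

lemma Rz_of_zrec (hE : Eulerian A) (hC : Connected A) {ρ : V → ℤ} (hρ : ZRec A z ρ) :
    Rz A z ρ = ρ :=
  Rz_eq_of_equiv (v := fun _ => 0) hE hC hρ 0 fun j => by simp [hE.lap_const]

lemma stabilizable_iff (hE : Eulerian A) (hC : Connected A) (z : V) (s : V → ℤ) :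
    Stabilizable A s ↔ mz A z s < 0 := by
  obtain ⟨v, h1, -, h3⟩ := Rz_spec_mz hE hC z s
  constructor
  · rintro ⟨l, -, hl⟩
    rw [applySeq_eq] at hl
    let w : V → ℤ := fun k => v k + (l.count k : ℤ)
    have hw : ∀ j, s j + lap A (fun k => (l.count k : ℤ)) j =
        Rz A z s j + mz A z s * delta z j + lap A w j := fun j => by
      rw [lap_add, h3 j]
      ring
    obtain ⟨x, -, hx⟩ := Finset.exists_min_image Finset.univ w ⟨z, Finset.mem_univ z⟩
    rcases (hx z (Finset.mem_univ z)).lt_or_eq with hlt | heq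
    · obtain ⟨i, hi, h4⟩ := exists_unstable_of_min hE (h1.noForbidden hE) (x := x) (v := w)
        (fun k => hx k (Finset.mem_univ k)) hlt
      have h5 := hl i not_false
      simp only [hw, delta, hi, if_false, mul_zero, add_zero] at h5
      omega
    · have h5 := hl z not_false
      have h6 : 0 ≤ lap A w z := by
        rw [hE.lap_eq]
        refine Finset.sum_nonneg fun j _ => mul_nonneg (by positivity) ?_
        have := hx j (Finset.mem_univ j)
        omega
      simp only [hw, delta, if_true, mul_one, h1.1] at h5
      omega
  · intro hm
    refine stabilizableVia_of_lap hE _ s (fun j => -v j) fun i _ => ?_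
    simp only [lap_neg]
    rw [h3 i]
    by_cases hi : i = z
    · subst hi
      simp only [h1.1, delta, if_true, mul_one]
      omega
    · have := h1.2.1 i hi
      simp only [delta, hi, if_false, mul_zero, add_zero]
      omega

/-- The open addition operator represents addition in the sandpile group, and its burst size is
nonnegative. -/
lemma openAdd_spec (hE : Eulerian A) (hC : Connected A) {ρ : V → ℤ} (hρ : ZRec A z ρ) (i : V) :
    ZRec A z (openAdd A z i ρ) ∧ ∃ c : ℤ, 0 ≤ c ∧ ∃ v : V → ℤ,
      ∀ j, ρ j + delta i j = openAdd A z i ρ j + c * delta z j + lap A v j := by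
  obtain ⟨hl, hl'⟩ := stabSeq_spec (sinkStabilizable hE hC z (fun k => ρ k + delta i k))
  have h0 : NoForbidden A z (fun k => ρ k + delta i k) := (hρ.noForbidden hE).mono fun j _ => by
    simp only [delta]
    split_ifs <;> simp
  have h1 := h0.applySeq hl
  have e : ∀ j, openAdd A z i ρ j = if j = z then (deg A z : ℤ) else
      applySeq A (fun k => ρ k + delta i k)
        (stabSeq A (fun i => i = z) (fun k => ρ k + delta i k)) j := fun j => rfl
  set l := stabSeq A (fun i => i = z) (fun k => ρ k + delta i k)
  refine ⟨(zrec_iff hE).mpr ⟨by simp [e], fun j hj => ?_, h1.mono fun j hj => ?_⟩, ?_⟩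
  · rw [e, if_neg hj]
    exact hl' j hj
  · rw [e, if_neg hj]
  · rw [applySeq_eq] at e
    have hz : l.count z = 0 := List.count_eq_zero_of_not_mem (hl.not_mem rfl)
    refine ⟨delta i z + lap A (fun k => (l.count k : ℤ)) z, ?_, fun k => -(l.count k : ℤ), ?_⟩
    · have : 0 ≤ delta i z := by
        simp only [delta]
        split_ifs <;> simp
      have h2 : 0 ≤ lap A (fun k => (l.count k : ℤ)) z := by
        simp only [lap, hz]
        simp only [Nat.cast_zero, mul_zero, zero_add]
        positivity
      linarith
    · intro j
      rw [e, lap_neg]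
      by_cases hj : j = z
      · subst hj
        rw [if_pos rfl, hρ.1]
        simp only [delta, if_true]
        ring
      · simp [delta, hj]

lemma totalMass_openAdd_le (hE : Eulerian A) (hC : Connected A) {ρ : V → ℤ} (hρ : ZRec A z ρ)
    (i : V) : totalMass (openAdd A z i ρ) ≤ totalMass ρ + 1 := by
  obtain ⟨-, c, hc, v, h⟩ := openAdd_spec hE hC hρ i
  have e := congrArg totalMass (funext h)
  rw [totalMass_add, totalMass_add, totalMass_add, totalMass_lap, totalMass_mul_delta,
    totalMass_delta] at e
  linarith

lemma Rz_add_delta (hE : Eulerian A) (hC : Connected A) (s : V → ℤ) (i : V) :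
    Rz A z (fun j => s j + delta i j) = openAdd A z i (Rz A z s) := by
  obtain ⟨m, v, h⟩ := Rz_spec hE hC z s
  obtain ⟨h1, c, -, v', h2⟩ := openAdd_spec hE hC h.1 i
  refine Rz_eq_of_equiv (v := fun j => v' j + v j) hE hC h1 (c + m) fun j => ?_
  have := h.2.2 j
  have := h2 j
  rw [lap_add]
  linarith

lemma closedAdd_spec (A : V → V → ℕ) (i : V) (s : V → ℤ) :
    ∃ v : V → ℤ, closedAdd A i s = fun j => (s j + delta i j) + lap A v j := by
  rw [closedAdd]
  split_ifs
  · rw [stabilizeVia, applySeq_eq]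
    exact ⟨_, rfl⟩
  · refine ⟨fun _ => 0, ?_⟩
    simp [lap]

lemma Rz_closedAdd (hE : Eulerian A) (hC : Connected A) (s : V → ℤ) (i : V) :
    Rz A z (closedAdd A i s) = openAdd A z i (Rz A z s) := by
  obtain ⟨v, hv⟩ := closedAdd_spec A i s
  rw [hv, ← Rz_add_delta hE hC]
  exact Rz_congr (v := v) hE hC 0 fun j => by simp

lemma totalMass_closedAdd (s : V → ℤ) (i : V) :
    totalMass (closedAdd A i s) = totalMass s + 1 := by
  obtain ⟨v, hv⟩ := closedAdd_spec A i s
  rw [hv, totalMass_add, totalMass_add, totalMass_lap, totalMass_delta]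
  ring

lemma chain_append_singleton (s : V → ℤ) (w : List V) (i : V) :
    chain A s (w ++ [i]) = closedAdd A i (chain A s w) := by
  simp [chain]

lemma totalMass_chain (s : V → ℤ) (w : List V) :
    totalMass (chain A s w) = totalMass s + w.length := by
  induction w using List.reverseRecOn with
  | nil => simp [chain]
  | append_singleton w i ih =>
    rw [chain_append_singleton, totalMass_closedAdd, ih, List.length_append]
    push_cast
    simp
    ring

lemma Rz_chain_append (hE : Eulerian A) (hC : Connected A) (s : V → ℤ) (w : List V) (i : V) :
    Rz A z (chain A s (w ++ [i])) = openAdd A z i (Rz A z (chain A s w)) := by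
  rw [chain_append_singleton, Rz_closedAdd hE hC]

lemma mz_chain (hE : Eulerian A) (hC : Connected A) (s : V → ℤ) (w : List V) :
    mz A z (chain A s w) = totalMass s + w.length - totalMass (Rz A z (chain A s w)) := by
  rw [mz_eq hE hC, totalMass_chain]

lemma mz_chain_append (hE : Eulerian A) (hC : Connected A) (s : V → ℤ) (w : List V) (i : V) :
    mz A z (chain A s (w ++ [i])) = mz A z (chain A s w) + 1 + totalMass (Rz A z (chain A s w)) -
      totalMass (openAdd A z i (Rz A z (chain A s w))) := by
  rw [mz_chain hE hC, mz_chain hE hC, Rz_chain_append hE hC, List.length_append]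
  push_cast
  simp
  ring

lemma mz_chain_mono (hE : Eulerian A) (hC : Connected A) (s : V → ℤ) {w w' : List V}
    (h : w <+: w') : mz A z (chain A s w) ≤ mz A z (chain A s w') := by
  obtain ⟨t, rfl⟩ := h
  induction t using List.reverseRecOn with
  | nil => simp
  | append_singleton t i ih =>
    rw [← List.append_assoc, mz_chain_append hE hC]
    have := totalMass_openAdd_le hE hC (zrec_Rz hE hC z (chain A s (w ++ t))) i
    linarith

lemma isThresholdWord_nil_iff (hE : Eulerian A) (hC : Connected A) (z : V) (s : V → ℤ) :
    IsThresholdWord A s [] ↔ 0 ≤ mz A z (chain A s []) := by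
  rw [IsThresholdWord, stabilizable_iff hE hC z, not_lt, and_iff_left_iff_imp]
  intro _ w hw hne
  exact absurd (List.prefix_nil.mp hw) hne

lemma isThresholdWord_append_iff (hE : Eulerian A) (hC : Connected A) (z : V) (s : V → ℤ)
    (w : List V) (i : V) :
    IsThresholdWord A s (w ++ [i]) ↔
      mz A z (chain A s w) < 0 ∧ 0 ≤ mz A z (chain A s (w ++ [i])) := by
  rw [IsThresholdWord, stabilizable_iff hE hC z, not_lt]
  constructor
  · rintro ⟨h1, h2⟩
    refine ⟨(stabilizable_iff hE hC z _).mp (h2 w (List.prefix_append w [i]) ?_), h1⟩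
    simp
  · rintro ⟨h1, h2⟩
    refine ⟨h2, fun w' hw hne => (stabilizable_iff hE hC z _).mpr ?_⟩
    have : w' <+: w := (List.prefix_concat_iff.mp (by simpa using hw)).resolve_left hne
    exact (mz_chain_mono hE hC s this).trans_lt h1

/-- The recurrent sandpiles lie in a box. -/
lemma ZRec.mem_Icc (hE : Eulerian A) {ρ : V → ℤ} (h : ZRec A z ρ) :
    ρ ∈ Set.Icc (fun _ => (0 : ℤ)) (fun j => (deg A j : ℤ)) := by
  refine ⟨fun j => ?_, fun j => ?_⟩
  · by_cases hj : j = z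
    · subst hj
      simp [h.1]
    · obtain ⟨i, hi, h1⟩ := h.noForbidden hE {j} (by simp) (by simpa using Ne.symm hj)
      rw [Finset.mem_singleton] at hi
      subst hi
      refine le_trans ?_ h1
      positivity
  · by_cases hj : j = z
    · subst hj
      exact h.1.le
    · have := h.2.1 j hj
      simp only
      omega

lemma finite_zrec (hE : Eulerian A) (z : V) : Finite {ρ : V → ℤ // ZRec A z ρ} :=
  ((Set.finite_Icc (fun _ : V => (0 : ℤ)) (fun j => (deg A j : ℤ))).subset
    (t := {ρ | ZRec A z ρ}) (fun _ h => ZRec.mem_Icc hE h)).to_subtype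

lemma ZRec.totalMass_nonneg (hE : Eulerian A) {ρ : V → ℤ} (h : ZRec A z ρ) : 0 ≤ totalMass ρ :=
  Finset.sum_nonneg fun j _ => (h.mem_Icc hE).1 j

lemma ZRec.totalMass_le (hE : Eulerian A) {ρ : V → ℤ} (h : ZRec A z ρ) :
    totalMass ρ ≤ ∑ j, (deg A j : ℤ) :=
  Finset.sum_le_sum fun j _ => (h.mem_Icc hE).2 j

/-- Every recurrent sandpile is reached from any other one by open additions. -/
lemma exists_openAdd_word (hE : Eulerian A) (hC : Connected A) {ρ ρ' : V → ℤ}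
    (hρ : ZRec A z ρ) (hρ' : ZRec A z ρ') :
    ∃ w : List V, w.foldl (fun r i => openAdd A z i r) ρ = ρ' := by
  have key : ∀ (w : List V) (s : V → ℤ),
      w.foldl (fun r i => openAdd A z i r) (Rz A z s) = Rz A z (fun j => s j + w.count j) := by
    intro w
    induction w with
    | nil => simp
    | cons i w ih =>
      intro s
      rw [List.foldl_cons, ← Rz_add_delta hE hC, ih]
      congr 1
      funext j
      by_cases hj : j = i
      · subst hj; simp [delta]; ring
      · simp [delta, hj, Ne.symm hj]
  obtain ⟨u, hu⟩ := exists_lap_ge hE hC z (fun j => ρ j - ρ' j)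
  let c : V → ℕ := fun j => if j = z then 0 else (ρ' j - ρ j + lap A u j).toNat
  let w : List V := (∑ j, c j • ({j} : Multiset V)).toList
  have hw : ∀ j, w.count j = c j := fun j => by
    have h1 : w.count j = Multiset.count j (∑ j, c j • ({j} : Multiset V)) := by
      rw [← Multiset.coe_count, Multiset.coe_toList]
    rw [h1, Multiset.count_sum']
    simp [Multiset.count_singleton]
  refine ⟨w, ?_⟩
  rw [← Rz_of_zrec hE hC hρ, key]
  refine Rz_eq_of_equiv (v := u) hE hC hρ' (-lap A u z) fun j => ?_
  rw [hw]
  by_cases hj : j = z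
  · subst hj
    simp [c, delta, hρ.1, hρ'.1]
  · have := hu j hj
    simp only [c, hj, if_false, delta, mul_zero, add_zero]
    rw [Int.toNat_of_nonneg (by linarith)]
    ring

lemma openAdd_injective (hE : Eulerian A) (hC : Connected A) {ρ ρ' : V → ℤ} (hρ : ZRec A z ρ)
    (hρ' : ZRec A z ρ') {i : V} (h : openAdd A z i ρ = openAdd A z i ρ') : ρ = ρ' := by
  obtain ⟨-, c, -, v, h1⟩ := openAdd_spec hE hC hρ i
  obtain ⟨-, c', -, v', h1'⟩ := openAdd_spec hE hC hρ' i
  refine hρ.eq_of_equiv (v := fun j => v j - v' j) hE hρ' (c - c') fun j => ?_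
  have h2 := h1 j
  have h3 := h1' j
  rw [h] at h2
  rw [lap_sub]
  linarith

lemma openAdd_sink (hE : Eulerian A) (hC : Connected A) {ρ : V → ℤ} (hρ : ZRec A z ρ) :
    openAdd A z z ρ = ρ := by
  have h := Rz_add_delta (z := z) hE hC ρ z
  rw [Rz_of_zrec hE hC hρ] at h
  rw [← h]
  exact Rz_eq_of_equiv (v := fun _ => 0) hE hC hρ 1 fun j => by simp [hE.lap_const]


section Mixing

variable {X : Type*} [Fintype X]

/-- One step of the averaging operator of the random walk generated by the permutations `σ`. -/
def walkAvg (α : V → ℝ) (σ : V → Equiv.Perm X) (f : X → ℝ) : X → ℝ :=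
  fun x => ∑ i, α i * f (σ i x)

variable {α : V → ℝ} {σ : V → Equiv.Perm X}

lemma sum_walkAvg (hα : ∑ i, α i = 1) (f : X → ℝ) : ∑ x, walkAvg α σ f x = ∑ x, f x := by
  simp only [walkAvg]
  rw [Finset.sum_comm]
  simp only [← Finset.mul_sum, Equiv.sum_comp, ← Finset.sum_mul, hα, one_mul]

lemma sum_walkAvg_iterate (hα : ∑ i, α i = 1) (f : X → ℝ) (n : ℕ) :
    ∑ x, (walkAvg α σ)^[n] f x = ∑ x, f x := by
  induction n with
  | zero => rfl
  | succ n ih => rw [Function.iterate_succ_apply', sum_walkAvg hα, ih]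

lemma walkAvg_iterate_affine (hα : ∑ i, α i = 1) (f : X → ℝ) (a c : ℝ) (n : ℕ) :
    (walkAvg α σ)^[n] (fun x => a * f x + c) = fun x => a * (walkAvg α σ)^[n] f x + c := by
  induction n with
  | zero => rfl
  | succ n ih =>
    rw [Function.iterate_succ_apply', Function.iterate_succ_apply', ih]
    funext x
    simp only [walkAvg, mul_add, Finset.sum_add_distrib, ← Finset.sum_mul, hα, one_mul,
      Finset.mul_sum]
    congr 1
    exact Finset.sum_congr rfl fun i _ => by ring

lemma walkAvg_iterate_nonneg (hpos : ∀ i, 0 < α i) {f : X → ℝ} (hf : ∀ x, 0 ≤ f x) (n : ℕ) (x : X) :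
    0 ≤ (walkAvg α σ)^[n] f x := by
  induction n generalizing x with
  | zero => exact hf x
  | succ n ih =>
    rw [Function.iterate_succ_apply']
    exact Finset.sum_nonneg fun i _ => mul_nonneg (hpos i).le (ih _)

lemma abs_walkAvg_iterate_le (hpos : ∀ i, 0 < α i) (hα : ∑ i, α i = 1) {f : X → ℝ} {M : ℝ}
    (hf : ∀ x, |f x| ≤ M) (n : ℕ) (x : X) : |(walkAvg α σ)^[n] f x| ≤ M := by
  have h1 := walkAvg_iterate_nonneg (σ := σ) hpos (f := fun x => 1 * f x + M)
    (fun x => by linarith [(abs_le.mp (hf x)).1]) n x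
  have h2 := walkAvg_iterate_nonneg (σ := σ) hpos (f := fun x => -1 * f x + M)
    (fun x => by linarith [(abs_le.mp (hf x)).2]) n x
  rw [walkAvg_iterate_affine hα] at h1 h2
  exact abs_le.mpr ⟨by linarith, by linarith⟩

lemma pow_mul_le_walkAvg_iterate (hpos : ∀ i, 0 < α i) {a : ℝ} (ha : 0 < a) (haα : ∀ i, a ≤ α i)
    {f : X → ℝ} (hf : ∀ x, 0 ≤ f x) (w : List V) (x : X) :
    a ^ w.length * f (w.foldl (fun y i => σ i y) x) ≤ (walkAvg α σ)^[w.length] f x := by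
  induction w generalizing x with
  | nil => simp
  | cons i w ih =>
    rw [List.length_cons, Function.iterate_succ_apply', List.foldl_cons, pow_succ']
    have h1 : α i * (walkAvg α σ)^[w.length] f (σ i x) ≤
        walkAvg α σ ((walkAvg α σ)^[w.length] f) x :=
      Finset.single_le_sum (f := fun i => α i * (walkAvg α σ)^[w.length] f (σ i x))
        (fun j _ => mul_nonneg (hpos j).le (walkAvg_iterate_nonneg hpos hf _ _))
        (Finset.mem_univ i)
    refine le_trans ?_ h1
    rw [mul_assoc]
    exact mul_le_mul (haα i) (ih (σ i x)) (mul_nonneg (by positivity) (hf _)) (hpos i).le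

/-- Uniform mixing of a lazy transitive random walk driven by permutations of a finite set. -/
lemma walkAvg_mixing (hpos : ∀ i, 0 < α i) (hα : ∑ i, α i = 1) (o : V) (ho : σ o = 1)
    (htrans : ∀ x y : X, ∃ w : List V, w.foldl (fun y i => σ i y) x = y) {ε : ℝ} (hε : 0 < ε) :
    ∃ N, ∀ n ≥ N, ∀ x₀ y : X,
      |(walkAvg α σ)^[n] (fun x => if x = x₀ then 1 else 0) y - 1 / (Fintype.card X : ℝ)| ≤ ε := by
  cases isEmpty_or_nonempty X with
  | inl h => exact ⟨0, fun _ _ x => isEmptyElim x⟩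
  | inr hX =>
  obtain ⟨j, hj⟩ : ∃ j, ∀ i, α j ≤ α i := by
    have : Nonempty V := ⟨o⟩
    exact Finite.exists_min α
  have hj1 : α j ≤ 1 := hα ▸ Finset.single_le_sum (fun i _ => (hpos i).le) (Finset.mem_univ j)
  choose W hW using htrans
  let N : ℕ := ∑ p : X × X, (W p.1 p.2).length
  have hN : ∀ x y, ∃ w : List V, w.length = N ∧ w.foldl (fun y i => σ i y) x = y := by
    intro x y
    have h1 : (W x y).length ≤ N :=
      Finset.single_le_sum (f := fun p : X × X => (W p.1 p.2).length) (fun _ _ => Nat.zero_le _)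
        (Finset.mem_univ (x, y))
    have h2 : ∀ k, (List.replicate k o).foldl (fun y i => σ i y) y = y := by
      intro k
      induction k with
      | zero => rfl
      | succ k ih => rw [List.replicate_succ, List.foldl_cons, ho, Equiv.Perm.one_apply, ih]
    refine ⟨W x y ++ List.replicate (N - (W x y).length) o, ?_, ?_⟩
    · simp only [List.length_append, List.length_replicate]
      omega
    · rw [List.foldl_append, hW, h2]
  let δ : ℝ := α j ^ N
  have hδ0 : 0 < δ := pow_pos (hpos j) N
  have hδ1 : δ ≤ 1 := pow_le_one₀ (hpos j).le hj1
  have half : ∀ (g : X → ℝ) (M : ℝ), ∑ x, g x = 0 → (∀ x, |g x| ≤ M) → ∀ x,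
      -((1 - δ) * M) ≤ (walkAvg α σ)^[N] g x := by
    intro g M hg hM x
    obtain ⟨y, hy⟩ : ∃ y, 0 ≤ g y := by
      by_contra! hh
      have := Finset.sum_lt_sum_of_nonempty (Finset.univ_nonempty (α := X)) fun y _ => hh y
      simp [hg] at this
    obtain ⟨w, hw, hwy⟩ := hN x y
    have h1 := pow_mul_le_walkAvg_iterate (σ := σ) hpos (hpos j) hj
      (f := fun x => 1 * g x + M) (fun x => by linarith [(abs_le.mp (hM x)).1]) w x
    rw [hw, walkAvg_iterate_affine hα, hwy] at h1
    change δ * (1 * g y + M) ≤ _ at h1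
    nlinarith
  have contr : ∀ (g : X → ℝ) (M : ℝ), ∑ x, g x = 0 → (∀ x, |g x| ≤ M) → ∀ x,
      |(walkAvg α σ)^[N] g x| ≤ (1 - δ) * M := by
    intro g M hg hM x
    have h1 := half g M hg hM x
    have h2 := half (fun x => -1 * g x + 0) M (by simp [hg]) (by simpa using hM) x
    rw [walkAvg_iterate_affine hα] at h2
    exact abs_le.mpr ⟨h1, by linarith⟩
  have iter : ∀ (g : X → ℝ), ∑ x, g x = 0 → (∀ x, |g x| ≤ 1) → ∀ (k : ℕ) (x : X),
      |(walkAvg α σ)^[N * k] g x| ≤ (1 - δ) ^ k := by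
    intro g hg hM k
    induction k with
    | zero => simpa using hM
    | succ k ih =>
      intro x
      rw [Nat.mul_succ, add_comm, Function.iterate_add_apply, pow_succ']
      exact contr _ _ (by rw [sum_walkAvg_iterate hα, hg]) ih x
  obtain ⟨K, hK⟩ := exists_pow_lt_of_lt_one hε (show 1 - δ < 1 by linarith)
  refine ⟨N * K, fun n hn x₀ y => ?_⟩
  have hcard : (1 : ℝ) ≤ Fintype.card X := by exact_mod_cast Fintype.card_pos
  let g : X → ℝ := fun x => 1 * (if x = x₀ then 1 else 0) + -(1 / (Fintype.card X : ℝ))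
  have hg : ∑ x, g x = 0 := by
    simp only [g, Finset.sum_add_distrib, one_mul]
    simp
  have hg1 : ∀ x, |g x| ≤ 1 := by
    intro x
    have h1 : 1 / (Fintype.card X : ℝ) ≤ 1 := by
      rw [div_le_one (by linarith)]
      exact hcard
    have h2 : 0 ≤ 1 / (Fintype.card X : ℝ) := by positivity
    simp only [g]
    rw [abs_le]
    split_ifs <;> constructor <;> linarith
  have h1 : (walkAvg α σ)^[n] g y =
      (walkAvg α σ)^[n] (fun x => if x = x₀ then 1 else 0) y - 1 / (Fintype.card X : ℝ) := by
    rw [walkAvg_iterate_affine hα]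
    ring
  rw [← h1, ← Nat.sub_add_cancel hn, Function.iterate_add_apply]
  exact (abs_walkAvg_iterate_le hpos hα (iter g hg hg1 K) _ y).trans hK.le

end Mixing

section Words

variable {α : V → ℝ}

/-- The finset of words of a given length. -/
def words (V : Type*) [Fintype V] [DecidableEq V] : ℕ → Finset (List V)
  | 0 => {[]}
  | n + 1 => (Finset.univ ×ˢ words V n).image fun p => p.2 ++ [p.1]

lemma mem_words {n : ℕ} {w : List V} : w ∈ words V n ↔ w.length = n := by
  induction n generalizing w with
  | zero => simp [words, List.length_eq_zero_iff]
  | succ n ih =>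
    simp only [words, Finset.mem_image, Finset.mem_product, Finset.mem_univ, true_and, Prod.exists]
    constructor
    · rintro ⟨i, u, hu, rfl⟩
      simp [ih.mp hu]
    · intro h
      rcases List.eq_nil_or_concat w with rfl | ⟨u, i, rfl⟩
      · simp at h
      · exact ⟨i, u, ih.mpr (by simpa using h), by simp⟩

lemma sum_words_succ (n : ℕ) (f : List V → ℝ) :
    ∑ w ∈ words V (n + 1), f w = ∑ i, ∑ w ∈ words V n, f (w ++ [i]) := by
  rw [words, Finset.sum_image, Finset.sum_product]
  rintro ⟨i, u⟩ - ⟨j, v⟩ - h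
  have := List.append_inj' h rfl
  simp_all

lemma wordProb_append (w : List V) (i : V) : wordProb α (w ++ [i]) = wordProb α w * α i := by
  simp [wordProb]

lemma thresholdProb_eq_sum (s : V → ℤ) (E : List V → Prop) (n : ℕ)
    (h : ∀ w, IsThresholdWord A s w → E w → w.length = n) :
    thresholdProb A α s E =
      ∑ w ∈ words V n, if IsThresholdWord A s w ∧ E w then wordProb α w else 0 :=
  tsum_eq_sum fun w hw => if_neg fun hE => hw (mem_words.mpr (h w hE.1 hE.2))

lemma summable_thresholdProb (s : V → ℤ) (E : List V → Prop) (n : ℕ)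
    (h : ∀ w, IsThresholdWord A s w → E w → w.length = n) :
    Summable fun w => if IsThresholdWord A s w ∧ E w then wordProb α w else 0 :=
  summable_of_ne_finset_zero (s := words V n)
    fun w hw => if_neg fun hE => hw (mem_words.mpr (h w hE.1 hE.2))

end Words


section Threshold

variable {α : V → ℝ}

/-- The open addition operator as a permutation of the recurrent sandpiles. -/
def openPerm (hE : Eulerian A) (hC : Connected A) (z i : V) :
    Equiv.Perm {ρ : V → ℤ // ZRec A z ρ} :=
  Equiv.ofBijective (fun ρ => ⟨openAdd A z i ρ, (openAdd_spec hE hC ρ.2 i).1⟩) <| by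
    have := finite_zrec hE z
    rw [← Finite.injective_iff_bijective]
    intro ρ ρ' h
    exact Subtype.ext (openAdd_injective hE hC ρ.2 ρ'.2 (congrArg Subtype.val h))

lemma openAdd_eq_iff (hE : Eulerian A) (hC : Connected A) (i : V) {ρ : V → ℤ} (hρ : ZRec A z ρ)
    (x : {ρ : V → ℤ // ZRec A z ρ}) :
    openAdd A z i ρ = x ↔ ρ = ((openPerm hE hC z i)⁻¹ x).1 := by
  have h : openPerm hE hC z i ⟨ρ, hρ⟩ = x ↔ (⟨ρ, hρ⟩ : {ρ // ZRec A z ρ}) =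
      (openPerm hE hC z i)⁻¹ x := Equiv.Perm.eq_inv_iff_eq.symm
  rwa [Subtype.ext_iff, Subtype.ext_iff] at h

lemma openAdd_inv (hE : Eulerian A) (hC : Connected A) (i : V)
    (x : {ρ : V → ℤ // ZRec A z ρ}) :
    openAdd A z i ((openPerm hE hC z i)⁻¹ x).1 = x :=
  (openAdd_eq_iff hE hC i ((openPerm hE hC z i)⁻¹ x).2 x).mpr rfl

/-- The probability that the recurrent representative equals `ρ` after `n` additions. -/
def visitProb (A : V → V → ℕ) (α : V → ℝ) (z : V) (s : V → ℤ) (n : ℕ) (ρ : V → ℤ) : ℝ :=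
  ∑ w ∈ words V n, if Rz A z (chain A s w) = ρ then wordProb α w else 0

lemma sum_words_last (hE : Eulerian A) (hC : Connected A) (s : V → ℤ) (n : ℕ) (i : V)
    (x : {ρ : V → ℤ // ZRec A z ρ}) :
    (∑ w ∈ words V n, if Rz A z (chain A s (w ++ [i])) = x then wordProb α (w ++ [i]) else 0) =
      α i * visitProb A α z s n ((openPerm hE hC z i)⁻¹ x).1 := by
  rw [visitProb, Finset.mul_sum]
  refine Finset.sum_congr rfl fun w _ => ?_
  simp only [Rz_chain_append hE hC, openAdd_eq_iff hE hC i (zrec_Rz hE hC z _), wordProb_append]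
  split_ifs
  · ring
  · ring

lemma visitProb_eq (hE : Eulerian A) (hC : Connected A) (s : V → ℤ) (n : ℕ)
    (x : {ρ : V → ℤ // ZRec A z ρ}) :
    visitProb A α z s n x = (walkAvg α fun i => (openPerm hE hC z i)⁻¹)^[n]
      (fun x => if x = ⟨Rz A z s, zrec_Rz hE hC z s⟩ then 1 else 0) x := by
  induction n generalizing x with
  | zero =>
    simp [visitProb, words, chain, wordProb, Subtype.ext_iff, eq_comm]
  | succ n ih =>
    rw [Function.iterate_succ_apply', visitProb, sum_words_succ]
    refine Finset.sum_congr rfl fun i _ => ?_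
    rw [sum_words_last hE hC, ih]

lemma visitProb_mixing (hE : Eulerian A) (hC : Connected A) (hpos : ∀ i, 0 < α i)
    (hα : ∑ i, α i = 1) (z : V) {ε : ℝ} (hε : 0 < ε) :
    ∃ N, ∀ n ≥ N, ∀ (s : V → ℤ) (x : {ρ : V → ℤ // ZRec A z ρ}),
      |visitProb A α z s n x - 1 / (kappa A z : ℝ)| ≤ ε := by
  have := finite_zrec hE z
  have := Fintype.ofFinite {ρ : V → ℤ // ZRec A z ρ}
  have hz : (openPerm hE hC z z)⁻¹ = 1 := by
    rw [inv_eq_one]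
    ext1 x
    exact Subtype.ext (openAdd_sink hE hC x.2)
  have key : ∀ (w : List V) (x : {ρ : V → ℤ // ZRec A z ρ}),
      w.reverse.foldl (fun y i => (openPerm hE hC z i)⁻¹ y)
        (w.foldl (fun y i => openPerm hE hC z i y) x) = x := by
    intro w
    induction w with
    | nil => simp
    | cons i w ih =>
      intro x
      rw [List.reverse_cons, List.foldl_append, List.foldl_cons (l := w), ih]
      simp
  have hcoe : ∀ (w : List V) (x : {ρ : V → ℤ // ZRec A z ρ}),
      (w.foldl (fun y i => openPerm hE hC z i y) x).1 =
        w.foldl (fun r i => openAdd A z i r) x.1 := by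
    intro w
    induction w with
    | nil => simp
    | cons i w ih =>
      intro x
      rw [List.foldl_cons, ih]
      rfl
  obtain ⟨N, hN⟩ := walkAvg_mixing (σ := fun i => (openPerm hE hC z i)⁻¹) hpos hα z hz
    (fun x y => by
      obtain ⟨w, hw⟩ := exists_openAdd_word hE hC y.2 x.2
      refine ⟨w.reverse, ?_⟩
      have : w.foldl (fun y i => openPerm hE hC z i y) y = x := Subtype.ext ((hcoe w y).trans hw)
      rw [← this, key]) hε
  refine ⟨N, fun n hn s x => ?_⟩
  rw [visitProb_eq hE hC, kappa, Nat.card_eq_fintype_card]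
  convert hN n hn _ x

lemma tendsto_visitProb (hE : Eulerian A) (hC : Connected A) (hpos : ∀ i, 0 < α i)
    (hα : ∑ i, α i = 1) (z : V) (c : ℤ) (x : {ρ : V → ℤ // ZRec A z ρ}) :
    Tendsto (fun s => visitProb A α z s (c - totalMass s).toNat x)
      (comap totalMass atBot) (nhds (1 / (kappa A z : ℝ))) := by
  rw [Metric.tendsto_nhds]
  intro ε hε
  obtain ⟨N, hN⟩ := visitProb_mixing hE hC hpos hα z (half_pos hε)
  have h : ∀ᶠ s : V → ℤ in comap totalMass atBot, totalMass s ≤ c - N :=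
    tendsto_comap.eventually (eventually_le_atBot (c - N : ℤ))
  filter_upwards [h] with s hs
  rw [Real.dist_eq]
  exact (hN _ (by omega) s x).trans_lt (half_lt_self hε)

lemma thresholdProb_congr (s : V → ℤ) {E E' : List V → Prop} (h : ∀ w, E w ↔ E' w) :
    thresholdProb A α s E = thresholdProb A α s E' := by
  rw [show E = E' from funext fun w => propext (h w)]

lemma thresholdProb_eq_zero (s : V → ℤ) {E : List V → Prop} (h : ∀ w, ¬ E w) :
    thresholdProb A α s E = 0 := by
  simp [thresholdProb, h]

/-- Threshold probabilities of events prescribing the last vertex and the final recurrent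
decomposition, in terms of the words preceding the last addition. -/
lemma thresholdProb_last (hE : Eulerian A) (hC : Connected A) (Q : List V → Prop) (i : V)
    (x : {ρ : V → ℤ // ZRec A z ρ}) (m n : ℕ) {s : V → ℤ}
    (hn : (n : ℤ) + 1 = totalMass x.1 + m - totalMass s) :
    thresholdProb A α s (fun w => Q w.dropLast ∧ w.getLast? = some i ∧
        Rz A z (chain A s w) = x ∧ mz A z (chain A s w) = (m : ℤ)) =
      if (m : ℤ) ≤ totalMass ((openPerm hE hC z i)⁻¹ x).1 - totalMass x.1 then
        α i * ∑ w ∈ words V n,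
          if Rz A z (chain A s w) = ((openPerm hE hC z i)⁻¹ x).1 ∧ Q w then wordProb α w else 0
      else 0 := by
  obtain ⟨y, hy⟩ : ∃ y, y = (openPerm hE hC z i)⁻¹ x := ⟨_, rfl⟩
  have hyx : openAdd A z i y.1 = x := by rw [hy]; exact openAdd_inv hE hC i x
  rw [← hy]
  have hiff : ∀ w ∈ words V n, (IsThresholdWord A s (w ++ [i]) ∧ Q (w ++ [i]).dropLast ∧
      (w ++ [i]).getLast? = some i ∧ Rz A z (chain A s (w ++ [i])) = x ∧
      mz A z (chain A s (w ++ [i])) = (m : ℤ)) ↔ (m : ℤ) ≤ totalMass y.1 - totalMass x.1 ∧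
        Rz A z (chain A s w) = y.1 ∧ Q w := by
    intro w hw
    have hw := mem_words.mp hw
    rw [isThresholdWord_append_iff hE hC z, List.dropLast_concat, List.getLast?_concat]
    simp only [true_and]
    rw [Rz_chain_append hE hC, openAdd_eq_iff hE hC i (zrec_Rz hE hC z _), ← hy]
    constructor
    · rintro ⟨⟨h1, -⟩, hQ, h2, -⟩
      refine ⟨?_, h2, hQ⟩
      rw [mz_chain hE hC, h2, hw] at h1
      omega
    · rintro ⟨h1, h2, hQ⟩
      have h3 : mz A z (chain A s w) < 0 := by
        rw [mz_chain hE hC, h2, hw]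
        omega
      have h4 : mz A z (chain A s (w ++ [i])) = m := by
        rw [mz_chain_append hE hC, h2, hyx, mz_chain hE hC, h2, hw]
        omega
      exact ⟨⟨h3, by omega⟩, hQ, h2, h4⟩
  rw [thresholdProb_eq_sum _ _ (n + 1), sum_words_succ, Finset.sum_eq_single i]
  · split_ifs with hm
    · rw [Finset.mul_sum]
      refine Finset.sum_congr rfl fun w hw => ?_
      by_cases h : Rz A z (chain A s w) = y.1 ∧ Q w
      · rw [if_pos ((hiff w hw).mpr ⟨hm, h⟩), if_pos h, wordProb_append, mul_comm]
      · rw [if_neg fun h' => h ((hiff w hw).mp h').2, if_neg h, mul_zero]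
    · exact Finset.sum_eq_zero fun w hw => if_neg fun h => hm ((hiff w hw).mp h).1
  · intro j _ hj
    exact Finset.sum_eq_zero fun w _ => if_neg fun h => hj (by simpa using h.2.2.1)
  · simp
  · rintro w - ⟨-, -, h1, h2⟩
    rw [mz_chain hE hC, h1] at h2
    omega

/-- Threshold probabilities of events prescribing the last vertex and the final recurrent
decomposition. -/
lemma thresholdProb_triple (hE : Eulerian A) (hC : Connected A) (i : V)
    (x : {ρ : V → ℤ // ZRec A z ρ}) (m : ℕ) {s : V → ℤ} (hs : totalMass s < 0) :
    thresholdProb A α s (fun w => w.getLast? = some i ∧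
        Rz A z (chain A s w) = x ∧ mz A z (chain A s w) = (m : ℤ)) =
      if (m : ℤ) ≤ totalMass ((openPerm hE hC z i)⁻¹ x).1 - totalMass x.1 then
        α i * visitProb A α z s (totalMass x.1 + m - 1 - totalMass s).toNat
          ((openPerm hE hC z i)⁻¹ x).1
      else 0 := by
  have hx := x.2.totalMass_nonneg hE
  have h := thresholdProb_last (α := α) hE hC (fun _ => True) i x m
    (n := (totalMass x.1 + m - 1 - totalMass s).toNat) (s := s) (by omega)
  simpa only [true_and, and_true, visitProb] using h

/-- Threshold probabilities of events prescribing the last two vertices and the final recurrent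
decomposition. -/
lemma thresholdProb_quadruple (hE : Eulerian A) (hC : Connected A) (i' i : V)
    (x : {ρ : V → ℤ // ZRec A z ρ}) (m : ℕ) {s : V → ℤ} (hs : totalMass s < -1) :
    thresholdProb A α s (fun w => w.dropLast.getLast? = some i' ∧ w.getLast? = some i ∧
        Rz A z (chain A s w) = x ∧ mz A z (chain A s w) = (m : ℤ)) =
      if (m : ℤ) ≤ totalMass ((openPerm hE hC z i)⁻¹ x).1 - totalMass x.1 then
        α i * (α i' * visitProb A α z s (totalMass x.1 + m - 2 - totalMass s).toNat
          ((openPerm hE hC z i')⁻¹ ((openPerm hE hC z i)⁻¹ x)).1)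
      else 0 := by
  have hx := x.2.totalMass_nonneg hE
  rw [thresholdProb_last hE hC (fun w => w.getLast? = some i') i x m
    (n := (totalMass x.1 + m - 2 - totalMass s).toNat + 1) (s := s) (by omega),
    sum_words_succ, Finset.sum_eq_single i', ← sum_words_last hE hC]
  · simp
  · intro j _ hj
    exact Finset.sum_eq_zero fun w _ => if_neg fun h => hj (by simpa using h.2)
  · simp

/-- Prescribing also the penultimate recurrent sandpile either changes nothing or yields an
impossible event. -/
lemma thresholdProb_quintuple (hE : Eulerian A) (hC : Connected A) (i' i : V) (ρ' : V → ℤ)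
    (hρ' : ZRec A z ρ') (x : {ρ : V → ℤ // ZRec A z ρ}) (m : ℕ) (s : V → ℤ) :
    thresholdProb A α s (fun w => w.dropLast.getLast? = some i' ∧
        Rz A z (chain A s w.dropLast) = ρ' ∧ w.getLast? = some i ∧
        Rz A z (chain A s w) = x ∧ mz A z (chain A s w) = (m : ℤ)) =
      if x = openAdd A z i ρ' then
        thresholdProb A α s (fun w => w.dropLast.getLast? = some i' ∧ w.getLast? = some i ∧
          Rz A z (chain A s w) = x ∧ mz A z (chain A s w) = (m : ℤ))
      else 0 := by
  have hkey : ∀ w : List V, w.getLast? = some i → Rz A z (chain A s w) = x →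
      (Rz A z (chain A s w.dropLast) = ρ' ↔ x = openAdd A z i ρ') := by
    intro w h1 h2
    rcases List.eq_nil_or_concat' w with rfl | ⟨u, j, rfl⟩
    · simp at h1
    · rw [List.getLast?_concat, Option.some_inj] at h1
      subst h1
      rw [Rz_chain_append hE hC] at h2
      rw [List.dropLast_concat, ← h2]
      exact ⟨fun h => h ▸ rfl, fun h => openAdd_injective hE hC (zrec_Rz hE hC z _) hρ' h⟩
  split_ifs with hx
  · refine thresholdProb_congr s fun w => ?_
    have := hkey w
    tauto
  · refine thresholdProb_eq_zero s fun w => ?_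
    have := hkey w
    tauto

/-- Decomposition of an event on the penultimate state according to the final triple. -/
lemma thresholdProb_eq_sum_triples (hE : Eulerian A) (hC : Connected A) (z : V)
    [Fintype {ρ : V → ℤ // ZRec A z ρ}] (Q : List V → Prop) {s : V → ℤ} (hs : totalMass s < 0) :
    thresholdProb A α s (fun w => Q w.dropLast) =
      ∑ t : V × {ρ : V → ℤ // ZRec A z ρ} × Fin (∑ j, deg A j + 1),
        thresholdProb A α s (fun w => Q w.dropLast ∧ w.getLast? = some t.1 ∧
          Rz A z (chain A s w) = t.2.1 ∧ mz A z (chain A s w) = ((t.2.2 : ℕ) : ℤ)) := by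
  simp only [thresholdProb]
  rw [← Summable.tsum_finsetSum]
  · refine tsum_congr fun w => ?_
    by_cases h : IsThresholdWord A s w ∧ Q w.dropLast
    · rw [if_pos h]
      rcases List.eq_nil_or_concat' w with rfl | ⟨u, j, rfl⟩
      · exfalso
        have h1 := (isThresholdWord_nil_iff hE hC z s).mp h.1
        rw [mz_chain hE hC] at h1
        have := (zrec_Rz hE hC z (chain A s [])).totalMass_nonneg hE
        simp only [List.length_nil, Nat.cast_zero] at h1
        omega
      · obtain ⟨h1, h2⟩ := (isThresholdWord_append_iff hE hC z s u j).mp h.1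
        have h3 : mz A z (chain A s (u ++ [j])) ≤ ∑ j, (deg A j : ℤ) := by
          have h4 := (zrec_Rz hE hC z (chain A s u)).totalMass_le hE
          have h5 := (zrec_Rz hE hC z (chain A s (u ++ [j]))).totalMass_nonneg hE
          rw [mz_chain_append hE hC, ← Rz_chain_append hE hC]
          omega
        have h6 : (mz A z (chain A s (u ++ [j]))).toNat < ∑ j, deg A j + 1 := by
          zify
          omega
        rw [Finset.sum_eq_single (j, ⟨Rz A z (chain A s (u ++ [j])), zrec_Rz hE hC z _⟩,
          ⟨(mz A z (chain A s (u ++ [j]))).toNat, h6⟩)]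
        · rw [if_pos]
          refine ⟨h.1, h.2, by simp, rfl, ?_⟩
          simp only
          omega
        · rintro ⟨j', ⟨ρ, hρ⟩, m, hm⟩ - hne
          refine if_neg ?_
          rintro ⟨-, -, e1, e2, e3⟩
          refine hne ?_
          simp only [List.getLast?_concat, Option.some_inj] at e1
          simp only at e2 e3
          subst e1 e2
          simp [e3]
        · simp
    · rw [if_neg h, Finset.sum_eq_zero]
      exact fun t _ => if_neg fun h' => h ⟨h'.1, h'.2.1⟩
  · intro t _
    have := t.2.1.2.totalMass_nonneg hE
    refine summable_thresholdProb s _ (totalMass t.2.1.1 + (t.2.2 : ℕ) - totalMass s).toNat ?_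
    rintro w - ⟨-, -, h1, h2⟩
    rw [mz_chain hE hC, h1] at h2
    omega

lemma sum_range_ite_le (D : ℕ) {d : ℤ} (h1 : -1 ≤ d) (h2 : d ≤ D) :
    (∑ m : Fin (D + 1), if ((m : ℕ) : ℤ) ≤ d then (1 : ℝ) else 0) = d + 1 := by
  obtain ⟨k, hk⟩ := Int.eq_ofNat_of_zero_le (show 0 ≤ d + 1 by omega)
  rw [Fin.sum_univ_eq_sum_range (fun m : ℕ => if (m : ℤ) ≤ d then (1 : ℝ) else 0) (D + 1),
    ← Finset.sum_filter]
  have : (Finset.range (D + 1)).filter (fun m : ℕ => (m : ℤ) ≤ d) = Finset.range k := by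
    ext m
    simp only [Finset.mem_filter, Finset.mem_range]
    omega
  rw [this]
  simp only [Finset.sum_const, Finset.card_range, nsmul_eq_mul, mul_one]
  exact_mod_cast hk.symm

/-- The total mass of the limiting law of the final triple. -/
lemma sum_limit_triples (hE : Eulerian A) (hC : Connected A) (hα : ∑ i, α i = 1) (z : V)
    [Fintype {ρ : V → ℤ // ZRec A z ρ}] :
    (∑ t : V × {ρ : V → ℤ // ZRec A z ρ} × Fin (∑ j, deg A j + 1),
      if (((t.2.2 : ℕ) : ℤ) ≤ totalMass ((openPerm hE hC z t.1)⁻¹ t.2.1).1 - totalMass t.2.1.1) then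
        α t.1 * (1 / (kappa A z : ℝ)) else 0) = 1 := by
  have hκ : (kappa A z : ℝ) ≠ 0 := by
    have : Nonempty {ρ : V → ℤ // ZRec A z ρ} := ⟨⟨_, zrec_Rz hE hC z fun _ => 0⟩⟩
    rw [kappa, Nat.card_eq_fintype_card]
    exact_mod_cast Fintype.card_ne_zero
  have h1 : ∀ (i : V) (x : {ρ : V → ℤ // ZRec A z ρ}),
      (∑ m : Fin (∑ j, deg A j + 1),
        if (((m : ℕ) : ℤ) ≤ totalMass ((openPerm hE hC z i)⁻¹ x).1 - totalMass x.1) then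
          α i * (1 / (kappa A z : ℝ)) else 0) =
      α i * (1 / (kappa A z : ℝ)) *
        ((totalMass ((openPerm hE hC z i)⁻¹ x).1 : ℝ) - (totalMass x.1 : ℝ) + 1) := by
    intro i x
    have h2 := totalMass_openAdd_le hE hC ((openPerm hE hC z i)⁻¹ x).2 i
    rw [openAdd_inv hE hC] at h2
    have h3 := ((openPerm hE hC z i)⁻¹ x).2.totalMass_le hE
    have h4 := x.2.totalMass_nonneg hE
    have h5 := sum_range_ite_le (∑ j, deg A j)
      (d := totalMass ((openPerm hE hC z i)⁻¹ x).1 - totalMass x.1) (by omega)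
      (by push_cast; omega)
    push_cast at h5
    rw [← h5, Finset.mul_sum]
    simp only [mul_ite, mul_one, mul_zero]
  simp only [Fintype.sum_prod_type, h1]
  simp only [← Finset.mul_sum, Finset.sum_add_distrib, Finset.sum_sub_distrib]
  have h2 : ∀ i, ∑ x, (totalMass ((openPerm hE hC z i)⁻¹ x).1 : ℝ) =
      ∑ x : {ρ : V → ℤ // ZRec A z ρ}, (totalMass x.1 : ℝ) := fun i =>
    Equiv.sum_comp (openPerm hE hC z i)⁻¹
      fun x : {ρ : V → ℤ // ZRec A z ρ} => (totalMass x.1 : ℝ)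
  simp only [h2, sub_self, zero_add, Finset.sum_const, Finset.card_univ, nsmul_eq_mul, mul_one]
  rw [← Nat.card_eq_fintype_card (α := {ρ : V → ℤ // ZRec A z ρ})]
  change ∑ i, α i * (1 / (kappa A z : ℝ)) * (kappa A z : ℝ) = 1
  simp only [mul_assoc, one_div, inv_mul_cancel₀ hκ, mul_one, hα]

lemma eventually_totalMass_lt (c : ℤ) :
    ∀ᶠ s : V → ℤ in comap totalMass atBot, totalMass s < c :=
  tendsto_comap.eventually (eventually_lt_atBot c)

lemma tendsto_thresholdProb_triple (hE : Eulerian A) (hC : Connected A) (hpos : ∀ i, 0 < α i)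
    (hα : ∑ i, α i = 1) (i : V) (x : {ρ : V → ℤ // ZRec A z ρ}) (m : ℕ) :
    Tendsto (fun s => thresholdProb A α s (fun w => w.getLast? = some i ∧
        Rz A z (chain A s w) = x ∧ mz A z (chain A s w) = (m : ℤ)))
      (comap totalMass atBot)
      (nhds (if (m : ℤ) ≤ totalMass ((openPerm hE hC z i)⁻¹ x).1 - totalMass x.1 then
        α i * (1 / (kappa A z : ℝ)) else 0)) := by
  refine Tendsto.congr' (f₁ := fun s =>
    if (m : ℤ) ≤ totalMass ((openPerm hE hC z i)⁻¹ x).1 - totalMass x.1 then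
        α i * visitProb A α z s (totalMass x.1 + m - 1 - totalMass s).toNat
          ((openPerm hE hC z i)⁻¹ x).1
      else 0) ?_ ?_
  · filter_upwards [eventually_totalMass_lt 0] with s hs
    rw [thresholdProb_triple hE hC i x m hs]
  · split_ifs
    · exact (tendsto_visitProb hE hC hpos hα z _ _).const_mul _
    · exact tendsto_const_nhds

lemma tendsto_thresholdProb_quadruple (hE : Eulerian A) (hC : Connected A) (hpos : ∀ i, 0 < α i)
    (hα : ∑ i, α i = 1) (i' i : V) (x : {ρ : V → ℤ // ZRec A z ρ}) (m : ℕ) :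
    Tendsto (fun s => thresholdProb A α s (fun w => w.dropLast.getLast? = some i' ∧
        w.getLast? = some i ∧ Rz A z (chain A s w) = x ∧ mz A z (chain A s w) = (m : ℤ)))
      (comap totalMass atBot)
      (nhds (α i' * if (m : ℤ) ≤ totalMass ((openPerm hE hC z i)⁻¹ x).1 - totalMass x.1 then
        α i * (1 / (kappa A z : ℝ)) else 0)) := by
  refine Tendsto.congr' (f₁ := fun s =>
    if (m : ℤ) ≤ totalMass ((openPerm hE hC z i)⁻¹ x).1 - totalMass x.1 then
        α i * (α i' * visitProb A α z s (totalMass x.1 + m - 2 - totalMass s).toNat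
          ((openPerm hE hC z i')⁻¹ ((openPerm hE hC z i)⁻¹ x)).1)
      else 0) ?_ ?_
  · filter_upwards [eventually_totalMass_lt (-1)] with s hs
    rw [thresholdProb_quadruple hE hC i' i x m hs]
  · split_ifs
    · rw [mul_left_comm]
      exact ((tendsto_visitProb hE hC hpos hα z _ _).const_mul _).const_mul _
    · rw [mul_zero]
      exact tendsto_const_nhds

lemma tendsto_thresholdProb_penultimate (hE : Eulerian A) (hC : Connected A)
    (hpos : ∀ i, 0 < α i) (hα : ∑ i, α i = 1) (z i' : V) :
    Tendsto (fun s => thresholdProb A α s (fun w => w.dropLast.getLast? = some i'))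
      (comap totalMass atBot) (nhds (α i')) := by
  have := finite_zrec hE z
  have := Fintype.ofFinite {ρ : V → ℤ // ZRec A z ρ}
  have h := tendsto_finsetSum Finset.univ
    fun (t : V × {ρ : V → ℤ // ZRec A z ρ} × Fin (∑ j, deg A j + 1)) _ =>
      tendsto_thresholdProb_quadruple hE hC hpos hα i' t.1 t.2.1 t.2.2
  rw [← Finset.mul_sum, sum_limit_triples hE hC hα, mul_one] at h
  refine h.congr' ?_
  filter_upwards [eventually_totalMass_lt 0] with s hs
  exact (thresholdProb_eq_sum_triples hE hC z (fun w => w.getLast? = some i') hs).symm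

end Threshold

end ThresholdState

open ThresholdState in
/-- Joint limit law of `(i_{τ-1}, ρ_{τ-1}, i_τ, ρ_τ, m_τ)` as `|s₀| → -∞`:
it converges to `(α_{i'}/κ)·α_i·1{ρ = â_i ρ'}·1{0 ≤ m ≤ |ρ'| - |ρ|}`;
in particular the vertex `i_{τ-1}` is asymptotically independent of the
triple `(i_τ, ρ_τ, m_τ)`. -/
theorem statement_16 {V : Type*} [Fintype V] [DecidableEq V]
    (A : V → V → ℕ) (hEul : Eulerian A) (hConn : Connected A)
    (α : V → ℝ) (hαpos : ∀ j, 0 < α j) (hαsum : ∑ j, α j = 1)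
    (z : V) (i' i : V) (ρ' ρ : V → ℤ) (hρ' : ZRec A z ρ') (hρ : ZRec A z ρ) (m : ℕ) :
    ∀ ε : ℝ, 0 < ε → ∃ K : ℤ, K < 0 ∧ ∀ s0 : V → ℤ, totalMass s0 < K →
      |thresholdProb A α s0
          (fun w => w.dropLast.getLast? = some i' ∧
            Rz A z (chain A s0 w.dropLast) = ρ' ∧
            w.getLast? = some i ∧ Rz A z (chain A s0 w) = ρ ∧
            mz A z (chain A s0 w) = (m : ℤ))
        - (α i' / (kappa A z : ℝ)) * α i * (if ρ = openAdd A z i ρ' then 1 else 0)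
            * (if (m : ℤ) ≤ totalMass ρ' - totalMass ρ then 1 else 0)| ≤ ε ∧
      |thresholdProb A α s0
          (fun w => w.dropLast.getLast? = some i' ∧
            w.getLast? = some i ∧ Rz A z (chain A s0 w) = ρ ∧
            mz A z (chain A s0 w) = (m : ℤ))
        - thresholdProb A α s0 (fun w => w.dropLast.getLast? = some i')
            * thresholdProb A α s0
                (fun w => w.getLast? = some i ∧ Rz A z (chain A s0 w) = ρ ∧
                  mz A z (chain A s0 w) = (m : ℤ))| ≤ ε := by
  have hxval : ρ = (⟨ρ, hρ⟩ : {ρ : V → ℤ // ZRec A z ρ}).1 := rfl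
  set x : {ρ : V → ℤ // ZRec A z ρ} := ⟨ρ, hρ⟩
  rw [hxval]
  have hT := tendsto_thresholdProb_triple hEul hConn hαpos hαsum i x m
  have hQ := tendsto_thresholdProb_quadruple hEul hConn hαpos hαsum i' i x m
  have hP := tendsto_thresholdProb_penultimate hEul hConn hαpos hαsum z i'
  have h1 := (hQ.sub (hP.mul hT)).abs
  rw [sub_self, abs_zero] at h1
  have h2 : Tendsto (fun s0 => thresholdProb A α s0
          (fun w => w.dropLast.getLast? = some i' ∧
            Rz A z (chain A s0 w.dropLast) = ρ' ∧
            w.getLast? = some i ∧ Rz A z (chain A s0 w) = x.1 ∧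
            mz A z (chain A s0 w) = (m : ℤ))) (comap totalMass atBot)
      (nhds ((α i' / (kappa A z : ℝ)) * α i * (if x.1 = openAdd A z i ρ' then 1 else 0)
            * (if (m : ℤ) ≤ totalMass ρ' - totalMass x.1 then 1 else 0))) := by
    by_cases hx : x.1 = openAdd A z i ρ'
    · have hy : ρ' = ((openPerm hEul hConn z i)⁻¹ x).1 :=
        (openAdd_eq_iff hEul hConn i hρ' x).mp hx.symm
      rw [← hy] at hQ
      have e : (α i' / (kappa A z : ℝ)) * α i * (if x.1 = openAdd A z i ρ' then 1 else 0)
            * (if (m : ℤ) ≤ totalMass ρ' - totalMass x.1 then 1 else 0) =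
          α i' * if (m : ℤ) ≤ totalMass ρ' - totalMass x.1 then
            α i * (1 / (kappa A z : ℝ)) else 0 := by
        rw [if_pos hx]
        split_ifs
        · ring
        · ring
      rw [e]
      refine hQ.congr fun s => ?_
      rw [thresholdProb_quintuple hEul hConn i' i ρ' hρ' x m s, if_pos hx]
    · rw [if_neg hx, mul_zero, zero_mul]
      refine tendsto_const_nhds.congr fun s => ?_
      rw [thresholdProb_quintuple hEul hConn i' i ρ' hρ' x m s, if_neg hx]
  intro ε hε
  have h4 := (Metric.tendsto_nhds.mp h2 ε hε).and (h1.eventually_le_const hε)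
  rw [eventually_comap, eventually_atBot] at h4
  obtain ⟨K, hK⟩ := h4
  refine ⟨min K (-1), by omega, fun s0 hs => ?_⟩
  obtain ⟨e1, e2⟩ := hK (totalMass s0) (by omega) s0 rfl
  rw [Real.dist_eq] at e1
  exact ⟨e1.le, e2⟩
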